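/- Let b > 1 and n ∈ ℕ. The unique best Lévy-distance approximation of the Benford measure β_b among probability measures supported on at most n points is δ_x^p, where x_j = b^{(2j−1)L} + 2L (b^{2jL} − 1)/(b^{2L} − 1) − L = b^{P_j − L} − L and P_j = (1/log b) · log( b^{(2j−1)L} + 2L (b^{2jL} − 1)/(b^{2L} − 1) ) + L = log(x_j + L)/log b + L, for j = 1,…,n, and L is the unique solution of b^{2nL} = (2L + b(b^L − b^{−L}))/(2L + b^L − b^{−L}); in particular the support has exactly n points. Moreover d_L(β_b, δ_x^p) = ω_b · L, and lim_{n→∞} n · min_{y,q} d_L(β_b, δ_y^q) = ((max{b,2} − 1)/(2b − 2)) · (log(1 + b log b) − log(1 + log b))/log b. -/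

import Mathlib

open MeasureTheory Filter Set

noncomputable section

namespace BenfordApprox

/-- Right-hand limit `f₊` of a nondecreasing `f : ℝ → ℝ̄`, at an extended-real point. -/
def fplus (f : ℝ → EReal) (a : EReal) : EReal := sInf (f '' {x : ℝ | a < (x : EReal)})

/-- Left-hand limit `f₋` of a nondecreasing `f : ℝ → ℝ̄`, at an extended-real point. -/
def fminus (f : ℝ → EReal) (a : EReal) : EReal := sSup (f '' {x : ℝ | (x : EReal) < a})

/-- The (upper) inverse function `f⁻¹(t) = sup {x : f x ≤ t}` (with `sup ∅ = ⊥`). -/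
def upperInv (f : ℝ → EReal) (t : ℝ) : EReal :=
  sSup ((fun x : ℝ => (x : EReal)) '' {x : ℝ | f x ≤ (t : EReal)})

/-- The upper inverse, for an extended-real argument. -/
def upperInvE (f : ℝ → EReal) (t : EReal) : EReal :=
  sSup ((fun x : ℝ => (x : EReal)) '' {x : ℝ | f x ≤ t})

/-- Lévy-type distance `d_L(f,g)` between nondecreasing functions `f g : ℝ → ℝ̄`. -/
def dLfun (f g : ℝ → EReal) : EReal :=
  sInf ((fun y : ℝ => (y : EReal)) ''
    {y : ℝ | 0 ≤ y ∧ ∀ x : ℝ, f (x - y) - (y : EReal) ≤ g x ∧ g x ≤ f (x + y) + (y : EReal)})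

/-- The auxiliary function `ℓ_{f,I}`; it depends on `I` only through `lo = inf I`, `hi = sup I`. -/
def ell (f : ℝ → EReal) (lo hi : EReal) (x : ℝ) : ℝ :=
  sInf {y : ℝ | 0 ≤ y ∧ fminus f (hi - (y : EReal)) - (y : EReal) ≤ (x : EReal) ∧
    (x : EReal) ≤ fplus f (lo + (y : EReal)) + (y : EReal)}

/-- The minimal value `ℓ*_{f,I} = min {y ≥ 0 : f₋(sup I − y) − y ≤ f₊(inf I + y) + y}`. -/
def ellStar (f : ℝ → EReal) (lo hi : EReal) : ℝ :=
  sInf {y : ℝ | 0 ≤ y ∧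
    fminus f (hi - (y : EReal)) - (y : EReal) ≤ fplus f (lo + (y : EReal)) + (y : EReal)}

/-- Distribution function `F_μ(t) = μ {y ∈ 𝕀 : y ≤ t}` of `μ`, where `𝕀 = [A,B]`. -/
def cdf (μ : Measure ℝ) (A B : ℝ) (t : ℝ) : ℝ := (μ (Icc A B ∩ Iic t)).toReal

/-- `F_μ` evaluated at an extended-real point (so `F_μ(−∞) = 0`, `F_μ(+∞) = 1`). -/
def cdfE (μ : Measure ℝ) (A B : ℝ) (a : EReal) : ℝ :=
  (μ (Icc A B ∩ {y : ℝ | (y : EReal) ≤ a})).toReal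

/-- Left limit `F_{μ−}` at an extended-real point (so `F_{μ−}(−∞) = 0`, `F_{μ−}(+∞) = 1`). -/
def cdfL (μ : Measure ℝ) (A B : ℝ) (a : EReal) : ℝ :=
  sSup ((cdf μ A B) '' {t : ℝ | (t : EReal) < a})

/-- Left limit `F_{μ−}` at a real point. -/
def cdfm (μ : Measure ℝ) (A B : ℝ) (t : ℝ) : ℝ := sSup ((cdf μ A B) '' Iio t)

/-- The (upper) quantile function `F_μ⁻¹` of `μ` on `𝕀 = [A,B]`, extended monotonically to `ℝ`. -/
def quant (μ : Measure ℝ) (A B : ℝ) (t : ℝ) : ℝ :=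
  if t < (μ {A}).toReal ∨ t < 0 then A
  else sSup {y ∈ Icc A B | cdf μ A B y ≤ t}

/-- Left limit `F⁻¹_{μ−}` of the quantile function. -/
def quantm (μ : Measure ℝ) (A B : ℝ) (t : ℝ) : ℝ := sSup ((quant μ A B) '' Iio t)

/-- `F_μ` as a function into the extended reals. -/
def cdfEReal (μ : Measure ℝ) (A B : ℝ) : ℝ → EReal := fun t => ((cdf μ A B t : ℝ) : EReal)

/-- `F_μ⁻¹` as a function into the extended reals. -/
def quantEReal (μ : Measure ℝ) (A B : ℝ) : ℝ → EReal := fun t => ((quant μ A B t : ℝ) : EReal)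

/-- The finitely supported measure `δ_x^p = Σ_j p_j δ_{x_j}`. -/
def discr (n : ℕ) (x p : Fin n → ℝ) : Measure ℝ :=
  ∑ j : Fin n, ENNReal.ofReal (p j) • Measure.dirac (x j)

/-- `p ∈ Π_n`: a probability vector. -/
def IsPi (n : ℕ) (p : Fin n → ℝ) : Prop := (∀ j, 0 ≤ p j) ∧ ∑ j, p j = 1

/-- `x ∈ Ξ_n`: a nondecreasing vector of locations in `𝕀 = [A,B]`. -/
def IsXi (A B : ℝ) (n : ℕ) (x : Fin n → ℝ) : Prop := (∀ j, x j ∈ Icc A B) ∧ Monotone x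

/-- The uniform weight vector `u_n = (1/n, …, 1/n)`. -/
def unif (n : ℕ) : Fin n → ℝ := fun _ => 1 / (n : ℝ)

/-- Partial sums `P_i = Σ_{j<i} p_j` (so `P_0 = 0`, `P_n = 1`). -/
def psum (n : ℕ) (p : Fin n → ℝ) (i : ℕ) : ℝ := ∑ j : Fin n, if (j : ℕ) < i then p j else 0

/-- Locations extended by `x_0 = −∞`, `x_{n+1} = +∞`; here `extPts n x j` is the paper's `x_j`. -/
def extPts (n : ℕ) (x : Fin n → ℝ) : ℕ → EReal := fun j =>
  if hj : j = 0 then ⊥ else if h : j ≤ n then ((x ⟨j - 1, by omega⟩ : ℝ) : EReal) else ⊤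

/-- `xcoord n x j` is the paper's `x_{j+1}` (0-based access). -/
def xcoord (n : ℕ) (x : Fin n → ℝ) (j : ℕ) : ℝ := if h : j < n then x ⟨j, h⟩ else 0

/-- The normalizing constant `ω = max{1, λ(𝕀)}/λ(𝕀)` for `𝕀 = [A,B]`. -/
def omegaI (A B : ℝ) : ℝ := max 1 (B - A) / (B - A)

/-- Lévy distance between Borel measures on `𝕀 = [A,B]`. -/
def dLevy (A B : ℝ) (μ ν : Measure ℝ) : ℝ :=
  omegaI A B * sInf {y : ℝ | 0 ≤ y ∧
    ∀ t : ℝ, cdf μ A B (t - y) - y ≤ cdf ν A B t ∧ cdf ν A B t ≤ cdf μ A B (t + y) + y}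

/-- Kolmogorov (uniform) distance between Borel measures on `𝕀 = [A,B]`. -/
def dKol (A B : ℝ) (μ ν : Measure ℝ) : ℝ :=
  sSup (Set.range fun t : ℝ => |cdf μ A B t - cdf ν A B t|)

/-- `L¹`-Kantorovich distance between Borel measures on `𝕀 = [A,B]`. -/
def dKant1 (A B : ℝ) (μ ν : Measure ℝ) : ℝ :=
  (B - A)⁻¹ * ∫ y in Ioo (0 : ℝ) 1, |quant μ A B y - quant ν A B y|

/-- `L^r`-Kantorovich distance between Borel measures on `𝕀 = [A,B]`. -/
def dKant (A B r : ℝ) (μ ν : Measure ℝ) : ℝ :=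
  (B - A)⁻¹ * (∫ y in Ioo (0 : ℝ) 1, |quant μ A B y - quant ν A B y| ^ r) ^ (1 / r)

/-- The Benford measure `β_b` on `[1,b]`: the law of `b^U` with `U` uniform on `[0,1)`. -/
def benford (b : ℝ) : Measure ℝ := (volume.restrict (Ico (0 : ℝ) 1)).map (fun t : ℝ => b ^ t)

/-- The map `T_{f,a}(x) = f₊(f⁻¹(x+a) + 2a) + a`. -/
def Tmap (f : ℝ → EReal) (a : ℝ) : EReal → EReal :=
  fun x => fplus f (upperInvE f (x + (a : EReal)) + ((2 * a : ℝ) : EReal)) + (a : EReal)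

/-- The map `S_{f,a}(x) = f₊(f⁻¹(x+a)) + a`. -/
def Smap (f : ℝ → EReal) (a : ℝ) : EReal → EReal :=
  fun x => fplus f (upperInvE f (x + (a : EReal))) + (a : EReal)

/-- `L_•^{•,n} = min {a ≥ 0 : T_{F_μ,a}^{[n]}(0) ≥ 1}`. -/
def LBB (μ : Measure ℝ) (A B : ℝ) (n : ℕ) : ℝ :=
  sInf {a : ℝ | 0 ≤ a ∧ (1 : EReal) ≤ (Tmap (cdfEReal μ A B) a)^[n] ((0 : ℝ) : EReal)}

/-- `K_•^{•,n} = min {a ≥ 0 : S_{F_μ,a}^{[n]}(0) ≥ 1}`. -/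
def KBB (μ : Measure ℝ) (A B : ℝ) (n : ℕ) : ℝ :=
  sInf {a : ℝ | 0 ≤ a ∧ (1 : EReal) ≤ (Smap (cdfEReal μ A B) a)^[n] ((0 : ℝ) : EReal)}


/-- The sequence `u_{k+1} = b^{2a} u_k + 2 a b^a`, `u_0 = 1`: the largest possible value of `b^{P_k}`
for a discrete measure at unnormalized Lévy distance at most `a` from `benford b`. -/
def levyRec (b a : ℝ) : ℕ → ℝ
  | 0 => 1
  | k + 1 => b ^ (2 * a) * levyRec b a k + 2 * a * b ^ a

section Recursion

variable {b a : ℝ}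

lemma one_le_levyRec (hb : 1 < b) (ha : 0 ≤ a) (k : ℕ) : 1 ≤ levyRec b a k := by
  induction k with
  | zero => simp [levyRec]
  | succ k ih =>
    have h1 : 1 ≤ b ^ (2 * a) := Real.one_le_rpow hb.le (by linarith)
    have h2 : 0 ≤ 2 * a * b ^ a := by positivity
    simp only [levyRec]
    nlinarith

lemma levyRec_strictMono (hb : 1 < b) (ha : 0 < a) : StrictMono (levyRec b a) := by
  refine strictMono_nat_of_lt_succ fun k => ?_
  have h0 := one_le_levyRec hb ha.le k
  have h1 : 1 < b ^ (2 * a) := Real.one_lt_rpow hb (by linarith)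
  have h2 : 0 ≤ 2 * a * b ^ a := by positivity
  simp only [levyRec]
  nlinarith

lemma continuous_levyRec (hb : 1 < b) (k : ℕ) : Continuous fun a => levyRec b a k := by
  have hb0 : b ≠ 0 := by positivity
  induction k with
  | zero => exact continuous_const
  | succ k ih =>
    simp only [levyRec]
    have h1 : Continuous fun a : ℝ => b ^ a := Real.continuous_const_rpow hb0
    have h2 : Continuous fun a : ℝ => b ^ (2 * a) := h1.comp (continuous_const.mul continuous_id)
    fun_prop

lemma levyRec_mono (hb : 1 < b) (k : ℕ) : MonotoneOn (fun a => levyRec b a k) (Ici 0) := by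
  intro a ha c hc hac
  simp only [mem_Ici] at ha hc
  induction k with
  | zero => simp [levyRec]
  | succ k ih =>
    have h0 := one_le_levyRec hb ha k
    simp only [levyRec] at ih ⊢
    have h1 : b ^ (2 * a) ≤ b ^ (2 * c) := Real.rpow_le_rpow_of_exponent_le hb.le (by linarith)
    have h2 : b ^ a ≤ b ^ c := Real.rpow_le_rpow_of_exponent_le hb.le hac
    gcongr

lemma levyRec_strictMonoOn (hb : 1 < b) {n : ℕ} (hn : 0 < n) :
    StrictMonoOn (fun a => levyRec b a n) (Ici 0) := by
  intro a ha c hc hac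
  obtain ⟨k, rfl⟩ := Nat.exists_eq_add_of_lt hn
  have hk := levyRec_mono hb k ha hc hac.le
  simp only [mem_Ici] at ha hc
  have h0 := one_le_levyRec hb ha k
  have h1 : b ^ (2 * a) < b ^ (2 * c) := Real.rpow_lt_rpow_of_exponent_lt hb (by linarith)
  have h2 : b ^ a ≤ b ^ c := Real.rpow_le_rpow_of_exponent_le hb.le hac.le
  have h3 : 2 * a * b ^ a ≤ 2 * c * b ^ c := by gcongr
  have h4 : b ^ (2 * a) * levyRec b a k < b ^ (2 * c) * levyRec b c k := by
    have : 0 < b ^ (2 * c) := by positivity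
    simp only at hk
    nlinarith
  simp only [zero_add, levyRec]
  linarith

lemma rpow_le_levyRec (hb : 1 < b) (ha : 0 ≤ a) (k : ℕ) : b ^ (2 * (k : ℝ) * a) ≤ levyRec b a k := by
  have hb0 : 0 < b := by positivity
  induction k with
  | zero => simp [levyRec]
  | succ k ih =>
    have h2 : 0 ≤ 2 * a * b ^ a := by positivity
    have h3 : b ^ (2 * ((k + 1 : ℕ) : ℝ) * a) = b ^ (2 * a) * b ^ (2 * (k : ℝ) * a) := by
      rw [← Real.rpow_add hb0]; congr 1; push_cast; ring
    have : 0 < b ^ (2 * a) := by positivity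
    simp only [levyRec]
    rw [h3]
    nlinarith

lemma levyRec_mul_eq (hb : 1 < b) (k : ℕ) :
    levyRec b a k * (b ^ (2 * a) - 1) =
      b ^ (2 * (k : ℝ) * a) * (b ^ (2 * a) - 1) + 2 * a * b ^ a * (b ^ (2 * (k : ℝ) * a) - 1) := by
  have hb0 : 0 < b := by positivity
  induction k with
  | zero => simp [levyRec]
  | succ k ih =>
    have h3 : b ^ (2 * ((k + 1 : ℕ) : ℝ) * a) = b ^ (2 * a) * b ^ (2 * (k : ℝ) * a) := by
      rw [← Real.rpow_add hb0]; congr 1; push_cast; ring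
    simp only [levyRec]
    rw [h3]
    linear_combination b ^ (2 * a) * ih

lemma levyRec_div (hb : 1 < b) (ha : 0 < a) (k : ℕ) :
    b ^ ((2 * (k : ℝ) + 1) * a) + 2 * a * (b ^ (2 * ((k : ℝ) + 1) * a) - 1) / (b ^ (2 * a) - 1) =
      levyRec b a (k + 1) / b ^ a := by
  have hb0 : 0 < b := by positivity
  have h1 : 1 < b ^ (2 * a) := Real.one_lt_rpow hb (by linarith)
  have h0 : 0 < b ^ a := by positivity
  have h2 : b ^ (2 * a) - 1 ≠ 0 := by linarith
  have h3 : b ^ (2 * ((k : ℝ) + 1) * a) = b ^ a * b ^ ((2 * (k : ℝ) + 1) * a) := by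
    rw [← Real.rpow_add hb0]; congr 1; ring
  have h4 := levyRec_mul_eq (a := a) hb (k + 1)
  push_cast at h4
  rw [eq_div_iff h0.ne', ← mul_right_cancel_iff_of_pos (sub_pos.2 h1), h4, h3]
  field_simp

lemma levy_equation_iff (hb : 1 < b) (ha : 0 < a) (n : ℕ) :
    b ^ (2 * (n : ℝ) * a) = (2 * a + b * (b ^ a - b ^ (-a))) / (2 * a + b ^ a - b ^ (-a)) ↔
      levyRec b a n = b := by
  have hb0 : 0 < b := by positivity
  have h0 : 0 < b ^ a := by positivity
  have h1 : 1 < b ^ (2 * a) := Real.one_lt_rpow hb (by linarith)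
  have h2 : b ^ (2 * a) = b ^ a * b ^ a := by rw [← Real.rpow_add hb0]; congr 1; ring
  have hm : b ^ a * b ^ (-a) = 1 := by rw [← Real.rpow_add hb0]; simp
  have h3 : b ^ (-a) < b ^ a := Real.rpow_lt_rpow_of_exponent_lt hb (by linarith)
  have h4 := levyRec_mul_eq (a := a) hb n
  rw [eq_div_iff (by linarith)]
  constructor
  · intro h
    rw [← mul_right_cancel_iff_of_pos (sub_pos.2 h1), h4, h2]
    linear_combination b ^ a * h + (b ^ (2 * (n : ℝ) * a) - b) * hm
  · intro h
    rw [h, h2] at h4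
    rw [← mul_right_cancel_iff_of_pos h0]
    linear_combination -h4 - (b ^ (2 * (n : ℝ) * a) - b) * hm

lemma exists_levyRec_eq (hb : 1 < b) {n : ℕ} (hn : 0 < n) : ∃ L, 0 < L ∧ levyRec b L n = b := by
  have h0 : levyRec b 0 n = 1 := by
    clear hn
    induction n with
    | zero => rfl
    | succ k ih => simp [levyRec, ih]
  have h1 : b ≤ levyRec b 1 n := by
    refine le_trans ?_ (rpow_le_levyRec hb zero_le_one n)
    have : (1 : ℝ) ≤ n := by exact_mod_cast hn
    exact Real.self_le_rpow_of_one_le hb.le (by linarith)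
  obtain ⟨L, hL, hLb⟩ := intermediate_value_Icc zero_le_one (continuous_levyRec hb n).continuousOn
    (show b ∈ Icc (levyRec b 0 n) (levyRec b 1 n) from ⟨h0 ▸ hb.le, h1⟩)
  refine ⟨L, lt_of_le_of_ne hL.1 ?_, hLb⟩
  rintro rfl
  simp only [h0] at hLb
  linarith

end Recursion

section Cdf

variable {b : ℝ}

lemma cdf_benford (hb : 1 < b) (t : ℝ) :
    cdf (benford b) 1 b t = Real.log (max 1 (min t b)) / Real.log b := by
  have hb0 : 0 < b := by positivity
  have hlog : 0 < Real.log b := Real.log_pos hb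
  have hm : Measurable fun t : ℝ => b ^ t := (Real.continuous_const_rpow hb0.ne').measurable
  have hmeas : MeasurableSet (Icc 1 b ∩ Iic t) := measurableSet_Icc.inter measurableSet_Iic
  rw [cdf, benford, Measure.map_apply hm hmeas, Measure.restrict_apply (hm hmeas)]
  rcases lt_or_ge t 1 with ht | ht
  · have : (fun t : ℝ => b ^ t) ⁻¹' (Icc 1 b ∩ Iic t) ∩ Ico 0 1 = ∅ := by
      ext s
      simp only [mem_inter_iff, mem_preimage, mem_Icc, mem_Iic, mem_empty_iff_false, iff_false]
      rintro ⟨⟨⟨h, -⟩, h'⟩, -⟩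
      linarith
    rw [this, max_eq_left ((min_le_left _ _).trans ht.le)]
    simp
  have key : ∀ s, b ^ s ≤ t ↔ s ≤ Real.log t / Real.log b := fun s => by
    rw [le_div_iff₀ hlog, ← Real.log_rpow hb0, Real.log_le_log_iff (by positivity) (by linarith)]
  have hone : ∀ s : ℝ, 0 ≤ s → 1 ≤ b ^ s := fun s hs => Real.one_le_rpow hb.le hs
  have hle : ∀ s : ℝ, s < 1 → b ^ s ≤ b := fun s hs => by
    simpa using Real.rpow_le_rpow_of_exponent_le hb.le hs.le
  rcases lt_or_ge t b with htb | htb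
  · have hc : Real.log t / Real.log b < 1 := by
      rw [div_lt_one hlog]; exact Real.log_lt_log (by linarith) htb
    have : (fun t : ℝ => b ^ t) ⁻¹' (Icc 1 b ∩ Iic t) ∩ Ico 0 1 =
        Icc 0 (Real.log t / Real.log b) := by
      ext s
      simp only [mem_inter_iff, mem_preimage, mem_Icc, mem_Iic, mem_Ico, key]
      constructor
      · rintro ⟨⟨-, h⟩, h', -⟩
        exact ⟨h', h⟩
      · rintro ⟨h, h'⟩
        exact ⟨⟨⟨hone s h, hle s (by linarith)⟩, h'⟩, h, by linarith⟩
    rw [this, min_eq_left htb.le, max_eq_right ht, Real.volume_Icc, sub_zero, ENNReal.toReal_ofReal]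
    have := Real.log_nonneg ht
    positivity
  · have : (fun t : ℝ => b ^ t) ⁻¹' (Icc 1 b ∩ Iic t) ∩ Ico 0 1 = Ico 0 1 := by
      ext s
      simp only [mem_inter_iff, mem_preimage, mem_Icc, mem_Iic, mem_Ico, and_iff_right_iff_imp]
      rintro ⟨h, h'⟩
      exact ⟨⟨hone s h, hle s h'⟩, (hle s h').trans htb⟩
    rw [this, min_eq_right htb, max_eq_right hb.le, div_self hlog.ne']
    simp

lemma continuous_cdf_benford (hb : 1 < b) : Continuous (cdf (benford b) 1 b) := by
  have : cdf (benford b) 1 b = fun t => Real.log (max 1 (min t b)) / Real.log b :=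
    funext (cdf_benford hb)
  rw [this]
  refine Continuous.div_const (Continuous.log (by fun_prop) fun t => ?_) _
  exact (lt_of_lt_of_le one_pos (le_max_left _ _)).ne'

lemma monotone_cdf_benford (hb : 1 < b) : Monotone (cdf (benford b) 1 b) := by
  intro s t hst
  have hlog : 0 < Real.log b := Real.log_pos hb
  rw [cdf_benford hb, cdf_benford hb]
  have : 0 < max 1 (min s b) := lt_of_lt_of_le one_pos (le_max_left _ _)
  gcongr

lemma cdf_benford_nonneg (t : ℝ) : 0 ≤ cdf (benford b) 1 b t := ENNReal.toReal_nonneg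

lemma cdf_benford_le_one (hb : 1 < b) (t : ℝ) : cdf (benford b) 1 b t ≤ 1 := by
  rw [cdf_benford hb, div_le_one (Real.log_pos hb)]
  exact Real.log_le_log (lt_of_lt_of_le one_pos (le_max_left _ _))
    (max_le hb.le (min_le_right _ _))

lemma cdf_benford_le (hb : 1 < b) {t : ℝ} (ht : 1 ≤ t) :
    cdf (benford b) 1 b t ≤ Real.log t / Real.log b := by
  rw [cdf_benford hb]
  have := Real.log_pos hb
  gcongr
  exact max_le ht (min_le_left _ _)

lemma cdf_benford_of_mem (hb : 1 < b) {t : ℝ} (ht : t ∈ Icc 1 b) :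
    cdf (benford b) 1 b t = Real.log t / Real.log b := by
  rw [cdf_benford hb, min_eq_left ht.2, max_eq_right ht.1]

variable {n : ℕ} {y q : Fin n → ℝ}

lemma cdf_discr (hy : ∀ j, y j ∈ Icc 1 b) (hq : ∀ j, 0 ≤ q j) (t : ℝ) :
    cdf (discr n y q) 1 b t = ∑ j, if y j ≤ t then q j else 0 := by
  have hmeas : MeasurableSet (Icc 1 b ∩ Iic t) := measurableSet_Icc.inter measurableSet_Iic
  rw [cdf, discr, Measure.coe_finsetSum, Finset.sum_apply, ENNReal.toReal_sum]
  · refine Finset.sum_congr rfl fun j _ => ?_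
    rw [Measure.smul_apply, Measure.dirac_apply' _ hmeas]
    by_cases h : y j ≤ t
    · rw [indicator_of_mem (show y j ∈ Icc 1 b ∩ Iic t from ⟨hy j, h⟩)]
      simp [h, hq j]
    · rw [indicator_of_notMem (show y j ∉ Icc 1 b ∩ Iic t from fun h' => h h'.2)]
      simp [h]
  · intro j _
    rw [Measure.smul_apply, Measure.dirac_apply' _ hmeas, smul_eq_mul]
    refine ENNReal.mul_ne_top ENNReal.ofReal_ne_top ?_
    by_cases h : y j ∈ Icc 1 b ∩ Iic t <;> simp [h]

lemma psum_le_cdf_discr (hy : ∀ j, y j ∈ Icc 1 b) (hq : ∀ j, 0 ≤ q j) {t : ℝ} {k : ℕ}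
    (h : ∀ j : Fin n, (j : ℕ) < k → y j ≤ t) : psum n q k ≤ cdf (discr n y q) 1 b t := by
  rw [cdf_discr hy hq, psum]
  refine Finset.sum_le_sum fun j _ => ?_
  by_cases hj : (j : ℕ) < k
  · simp [hj, h j hj]
  · rw [if_neg hj]
    split_ifs <;> simp [hq j]

lemma cdf_discr_le_psum (hy : ∀ j, y j ∈ Icc 1 b) (hq : ∀ j, 0 ≤ q j) {t : ℝ} {k : ℕ}
    (h : ∀ j : Fin n, y j ≤ t → (j : ℕ) < k) : cdf (discr n y q) 1 b t ≤ psum n q k := by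
  rw [cdf_discr hy hq, psum]
  refine Finset.sum_le_sum fun j _ => ?_
  by_cases hj : y j ≤ t
  · simp [hj, h j hj]
  · rw [if_neg hj]
    split_ifs <;> simp [hq j]

lemma psum_zero : psum n q 0 = 0 := by simp [psum]

lemma psum_self : psum n q n = ∑ j, q j := by simp [psum]

lemma psum_succ (j : Fin n) : psum n q (j + 1) = psum n q j + q j := by
  have : q j = ∑ i, if i = j then q i else 0 := by simp
  rw [psum, psum]
  conv_rhs => rw [this]
  rw [← Finset.sum_add_distrib]
  refine Finset.sum_congr rfl fun i _ => ?_
  rcases lt_trichotomy i j with h | h | h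
  · have h' : (i : ℕ) < j := h
    simp [h.ne, h', h'.trans (Nat.lt_succ_self _)]
  · simp [h]
  · have h' : (j : ℕ) < i := h
    simp [h.ne', h'.not_gt, h'.not_ge]

lemma psum_nonneg (hq : ∀ j, 0 ≤ q j) (k : ℕ) : 0 ≤ psum n q k :=
  Finset.sum_nonneg fun j _ => by split_ifs <;> simp [hq j]

end Cdf

/-- The admissible shifts in the definition of the Lévy distance between `benford b` and `ν`. -/
def levySet (b : ℝ) (ν : Measure ℝ) : Set ℝ :=
  {a : ℝ | 0 ≤ a ∧ ∀ t : ℝ, cdf (benford b) 1 b (t - a) - a ≤ cdf ν 1 b t ∧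
    cdf ν 1 b t ≤ cdf (benford b) 1 b (t + a) + a}

lemma dLevy_benford (b : ℝ) (ν : Measure ℝ) :
    dLevy 1 b (benford b) ν = (max b 2 - 1) / (b - 1) * sInf (levySet b ν) := by
  have : max 1 (b - 1) = max b 2 - 1 := by
    rw [max_comm b 2, ← max_sub_sub_right]; norm_num
  rw [dLevy, omegaI, this, levySet]

section Approximation

variable {b a L : ℝ} {n : ℕ} {x p y q : Fin n → ℝ}

lemma isClosed_levySet (hb : 1 < b) (ν : Measure ℝ) : IsClosed (levySet b ν) := by
  have hF := continuous_cdf_benford hb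
  simp only [levySet, ofPred_and, ofPred_forall]
  refine isClosed_Ici.inter (isClosed_iInter fun t => IsClosed.inter ?_ ?_)
  · exact isClosed_le (by fun_prop) continuous_const
  · exact isClosed_le continuous_const (by fun_prop)

lemma levySet_nonempty (hb : 1 < b) (hy : IsXi 1 b n y) (hq : IsPi n q) :
    (levySet b (discr n y q)).Nonempty := by
  refine ⟨1, zero_le_one, fun t => ⟨?_, ?_⟩⟩
  · have h1 := cdf_benford_le_one hb (t - 1)
    have h2 : 0 ≤ cdf (discr n y q) 1 b t := ENNReal.toReal_nonneg
    linarith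
  · have h1 := cdf_benford_nonneg (b := b) (t + 1)
    have h2 := cdf_discr_le_psum hy.1 hq.1 (t := t) (k := n) fun j _ => j.2
    rw [psum_self, hq.2] at h2
    linarith

lemma sInf_levySet_mem (hb : 1 < b) (hy : IsXi 1 b n y) (hq : IsPi n q) :
    sInf (levySet b (discr n y q)) ∈ levySet b (discr n y q) :=
  (isClosed_levySet hb _).csInf_mem (levySet_nonempty hb hy hq) ⟨0, fun _ h => h.1⟩

lemma le_of_mem_levySet (hb : 1 < b) (hy : IsXi 1 b n y) (hq : IsPi n q)
    (ha : a ∈ levySet b (discr n y q)) (j : Fin n) : y j ≤ b ^ (psum n q j + a) + a := by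
  have hb0 : 0 < b := by positivity
  have hlog := Real.log_pos hb
  have hQ := psum_nonneg hq.1 j
  have ha0 := ha.1
  have hleft : ∀ t < y j, cdf (benford b) 1 b (t - a) - a ≤ psum n q j := fun t ht =>
    (ha.2 t).1.trans <| cdf_discr_le_psum hy.1 hq.1 fun i hi => by
      by_contra h
      exact absurd (hy.2 (Fin.le_def.2 (not_lt.1 h))) (by linarith)
  have hlim : cdf (benford b) 1 b (y j - a) - a ≤ psum n q j := by
    have hF := continuous_cdf_benford hb
    have hc : Continuous fun t => cdf (benford b) 1 b (t - a) - a := by fun_prop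
    exact le_of_tendsto (hc.continuousAt.tendsto.mono_left nhdsWithin_le_nhds)
      (eventually_nhdsWithin_of_forall (s := Iio (y j)) hleft)
  rcases le_or_gt (y j - a) 1 with h | h
  · have : 1 ≤ b ^ (psum n q j + a) := Real.one_le_rpow hb.le (by linarith)
    linarith
  · rw [cdf_benford_of_mem hb ⟨h.le, by linarith [(hy.1 j).2]⟩] at hlim
    have h1 : Real.log (y j - a) ≤ (psum n q j + a) * Real.log b := by
      rw [← div_le_iff₀ hlog]; linarith
    rw [← Real.log_rpow hb0, Real.log_le_log_iff (by linarith) (by positivity)] at h1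
    linarith

lemma rpow_psum_succ_le (hb : 1 < b) (hy : IsXi 1 b n y) (hq : IsPi n q)
    (ha : a ∈ levySet b (discr n y q)) (j : Fin n) :
    b ^ psum n q (j + 1) ≤ b ^ a * (y j + a) := by
  have hb0 : 0 < b := by positivity
  have hlog := Real.log_pos hb
  have h1 := (hy.1 j).1
  have ha0 := ha.1
  have h2 : psum n q (j + 1) ≤ cdf (discr n y q) 1 b (y j) :=
    psum_le_cdf_discr hy.1 hq.1 fun i hi => hy.2 (Fin.le_def.2 (Nat.lt_succ_iff.1 hi))
  have h3 := h2.trans (ha.2 (y j)).2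
  have h4 := cdf_benford_le hb (t := y j + a) (by linarith)
  have h5 : (psum n q (j + 1) - a) * Real.log b ≤ Real.log (y j + a) := by
    rw [← le_div_iff₀ hlog]; linarith
  rw [← Real.log_rpow hb0, Real.log_le_log_iff (by positivity) (by linarith)] at h5
  calc b ^ psum n q (j + 1) = b ^ a * b ^ (psum n q (j + 1) - a) := by
        rw [← Real.rpow_add hb0]; congr 1; ring
    _ ≤ _ := by gcongr

lemma rpow_psum_succ_le_rec (hb : 1 < b) (hy : IsXi 1 b n y) (hq : IsPi n q)
    (ha : a ∈ levySet b (discr n y q)) (j : Fin n) :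
    b ^ psum n q (j + 1) ≤ b ^ (2 * a) * b ^ psum n q j + 2 * a * b ^ a := by
  have hb0 : 0 < b := by positivity
  have h0 : 0 < b ^ a := by positivity
  have h1 := rpow_psum_succ_le hb hy hq ha j
  have h2 := le_of_mem_levySet hb hy hq ha j
  have h3 : b ^ (2 * a) = b ^ a * b ^ a := by rw [← Real.rpow_add hb0]; congr 1; ring
  rw [Real.rpow_add hb0] at h2
  rw [h3]
  nlinarith

lemma rpow_psum_le_levyRec (hb : 1 < b) (hy : IsXi 1 b n y) (hq : IsPi n q)
    (ha : a ∈ levySet b (discr n y q)) {k : ℕ} (hk : k ≤ n) :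
    b ^ psum n q k ≤ levyRec b a k := by
  induction k with
  | zero => simp [psum_zero, levyRec]
  | succ k ih =>
    have h := rpow_psum_succ_le_rec hb hy hq ha ⟨k, hk⟩
    have : 0 < b ^ (2 * a) := by positivity
    have := ih (Nat.le_of_succ_le hk)
    refine h.trans ?_
    simp only [levyRec]
    gcongr

lemma le_of_mem_of_levyRec_eq (hb : 1 < b) (hn : 0 < n) (hL : 0 < L) (hLb : levyRec b L n = b)
    (hy : IsXi 1 b n y) (hq : IsPi n q) (ha : a ∈ levySet b (discr n y q)) : L ≤ a := by
  have h := rpow_psum_le_levyRec hb hy hq ha le_rfl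
  rw [psum_self, hq.2, Real.rpow_one] at h
  by_contra! h'
  have := levyRec_strictMonoOn hb hn (mem_Ici.2 ha.1) (mem_Ici.2 hL.le) h'
  simp only at this
  linarith

lemma rpow_psum_eq_levyRec (hb : 1 < b) (hLb : levyRec b L n = b) (hy : IsXi 1 b n y)
    (hq : IsPi n q) (hL : L ∈ levySet b (discr n y q)) {k : ℕ} (hk : k ≤ n) :
    b ^ psum n q k = levyRec b L k := by
  induction hk using Nat.decreasingInduction with
  | self => rw [psum_self, hq.2, Real.rpow_one, hLb]
  | of_succ k hk ih =>
    refine le_antisymm (rpow_psum_le_levyRec hb hy hq hL hk.le) ?_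
    have h := rpow_psum_succ_le_rec hb hy hq hL ⟨k, hk⟩
    simp only [ih, levyRec, add_le_add_iff_right] at h
    exact le_of_mul_le_mul_left h (by positivity)

lemma eq_of_mem_levySet (hb : 1 < b) (hLb : levyRec b L n = b) (hy : IsXi 1 b n y)
    (hq : IsPi n q) (hL : L ∈ levySet b (discr n y q)) (j : Fin n) :
    y j = levyRec b L (j + 1) / b ^ L - L := by
  have hb0 : 0 < b := by positivity
  have h0 : 0 < b ^ L := by positivity
  have h1 := rpow_psum_succ_le hb hy hq hL j
  have h2 := le_of_mem_levySet hb hy hq hL j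
  have h3 : b ^ (2 * L) = b ^ L * b ^ L := by rw [← Real.rpow_add hb0]; congr 1; ring
  rw [rpow_psum_eq_levyRec hb hLb hy hq hL j.2] at h1
  rw [Real.rpow_add hb0, rpow_psum_eq_levyRec hb hLb hy hq hL j.2.le] at h2
  apply le_antisymm
  · rw [le_sub_iff_add_le, le_div_iff₀ h0, levyRec, h3]
    nlinarith
  · rw [sub_le_iff_le_add, div_le_iff₀ h0]
    linarith

lemma psum_eq_of_mem_levySet (hb : 1 < b) (hLb : levyRec b L n = b) (hy : IsXi 1 b n y)
    (hq : IsPi n q) (hL : L ∈ levySet b (discr n y q)) {k : ℕ} (hk : k ≤ n) :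
    psum n q k = Real.log (levyRec b L k) / Real.log b := by
  rw [← rpow_psum_eq_levyRec hb hLb hy hq hL hk, Real.log_rpow (by positivity),
    mul_div_cancel_right₀ _ (Real.log_pos hb).ne']

lemma eq_of_psum_eq (h : ∀ k ≤ n, psum n p k = psum n q k) : p = q := by
  funext j
  have h1 := psum_succ (q := p) j
  have h2 := psum_succ (q := q) j
  rw [h _ j.2, h _ j.2.le] at h1
  linarith

lemma levyRec_succ_div (hb : 1 < b) (k : ℕ) :
    levyRec b L (k + 1) / b ^ L = b ^ L * levyRec b L k + 2 * L := by
  have hb0 : 0 < b := by positivity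
  have h0 : 0 < b ^ L := by positivity
  have h3 : b ^ (2 * L) = b ^ L * b ^ L := by rw [← Real.rpow_add hb0]; congr 1; ring
  rw [levyRec, h3]
  field_simp

lemma isXi_of_levyRec (hb : 1 < b) (hL : 0 < L) (hLb : levyRec b L n = b)
    (hx : ∀ j : Fin n, x j = levyRec b L (j + 1) / b ^ L - L) : IsXi 1 b n x ∧ StrictMono x := by
  have hb0 : 0 < b := by positivity
  have h1 : 1 ≤ b ^ L := Real.one_le_rpow hb.le hL.le
  have hmono : StrictMono x := fun i j hij => by
    have : levyRec b L (i + 1) < levyRec b L (j + 1) :=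
      levyRec_strictMono hb hL (Nat.succ_lt_succ hij)
    rw [hx, hx]
    gcongr
  refine ⟨⟨fun j => ⟨?_, ?_⟩, hmono.monotone⟩, hmono⟩
  · have := one_le_levyRec hb hL.le j
    rw [hx, levyRec_succ_div hb]
    nlinarith
  · have h2 : levyRec b L (j + 1) ≤ b :=
      ((levyRec_strictMono hb hL).monotone (Nat.succ_le_of_lt j.2)).trans_eq hLb
    have h3 : levyRec b L (j + 1) / b ^ L ≤ levyRec b L (j + 1) :=
      div_le_self (by linarith [one_le_levyRec hb hL.le (j + 1)]) h1
    rw [hx]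
    linarith

lemma isPi_of_levyRec (hb : 1 < b) (hL : 0 < L) (hLb : levyRec b L n = b)
    (hp : ∀ k ≤ n, psum n p k = Real.log (levyRec b L k) / Real.log b) : IsPi n p := by
  have hlog := Real.log_pos hb
  refine ⟨fun j => ?_, ?_⟩
  · have h1 := psum_succ (q := p) j
    rw [hp _ j.2, hp _ j.2.le] at h1
    have h2 : levyRec b L j < levyRec b L (j + 1) := levyRec_strictMono hb hL (Nat.lt_succ_self _)
    have h3 := one_le_levyRec hb hL.le j
    have h4 : Real.log (levyRec b L j) / Real.log b ≤
        Real.log (levyRec b L (j + 1)) / Real.log b := by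
      gcongr
    linarith
  · rw [← psum_self, hp n le_rfl, hLb, div_self hlog.ne']

lemma mem_levySet_of_levyRec (hb : 1 < b) (hL : 0 < L) (hLb : levyRec b L n = b)
    (hx : ∀ j : Fin n, x j = levyRec b L (j + 1) / b ^ L - L)
    (hp : ∀ k ≤ n, psum n p k = Real.log (levyRec b L k) / Real.log b) :
    L ∈ levySet b (discr n x p) := by
  have hb0 : 0 < b := by positivity
  have hlog := Real.log_pos hb
  have h1 : 1 ≤ b ^ L := Real.one_le_rpow hb.le hL.le
  obtain ⟨hxi, hmono⟩ := isXi_of_levyRec hb hL hLb hx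
  have hpi := isPi_of_levyRec hb hL hLb hp
  have hlogL : Real.log (b ^ L) / Real.log b = L := by
    rw [Real.log_rpow hb0, mul_div_cancel_right₀ _ hlog.ne']
  refine ⟨hL.le, fun t => ⟨?_, ?_⟩⟩
  · by_cases hS : ∃ j, t < x j
    · obtain ⟨j, hj, hmin⟩ := WellFounded.has_min wellFounded_lt {j | t < x j} hS
      have hG : psum n p j ≤ cdf (discr n x p) 1 b t :=
        psum_le_cdf_discr hxi.1 hpi.1 fun i hi => not_lt.1 fun h => hmin i h hi
      have hj0 := one_le_levyRec hb hL.le j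
      have h2 : cdf (benford b) 1 b (t - L) ≤ psum n p j + L := by
        calc cdf (benford b) 1 b (t - L) ≤ cdf (benford b) 1 b (b ^ L * levyRec b L j) := by
              refine monotone_cdf_benford hb ?_
              have : t < x j := hj
              rw [hx, levyRec_succ_div hb] at this
              linarith
          _ ≤ Real.log (b ^ L * levyRec b L j) / Real.log b := cdf_benford_le hb (by nlinarith)
          _ = psum n p j + L := by
              rw [Real.log_mul (by positivity) (by positivity), add_div, hlogL, hp _ j.2.le]
              ring
      linarith
    · push Not at hS
      have h2 := psum_le_cdf_discr hxi.1 hpi.1 (k := n) fun i _ => hS i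
      rw [psum_self, hpi.2] at h2
      linarith [cdf_benford_le_one hb (t - L)]
  · by_cases hS : ∃ j, x j ≤ t
    · obtain ⟨j, hj, hmax⟩ := WellFounded.has_min (wellFounded_gt (α := Fin n)) {j | x j ≤ t} hS
      have hG : cdf (discr n x p) 1 b t ≤ psum n p (j + 1) :=
        cdf_discr_le_psum hxi.1 hpi.1 fun i hi =>
          Nat.lt_succ_of_le (Fin.le_def.1 (not_lt.1 (hmax i hi)))
      have hU := one_le_levyRec hb hL.le (j + 1)
      have hxL : x j + L = levyRec b L (j + 1) / b ^ L := by rw [hx]; ring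
      have hle : x j + L ≤ b := by
        rw [hxL]
        exact (div_le_self (by linarith) h1).trans
          (((levyRec_strictMono hb hL).monotone (Nat.succ_le_of_lt j.2)).trans_eq hLb)
      have h2 : psum n p (j + 1) - L ≤ cdf (benford b) 1 b (t + L) := by
        calc psum n p (j + 1) - L = Real.log (x j + L) / Real.log b := by
              rw [hxL, Real.log_div (by positivity) (by positivity), sub_div, hlogL, hp _ j.2]
          _ = cdf (benford b) 1 b (x j + L) :=
              (cdf_benford_of_mem hb ⟨by linarith [(hxi.1 j).1], hle⟩).symm
          _ ≤ _ := monotone_cdf_benford hb (by have : x j ≤ t := hj; linarith)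
      linarith
    · push Not at hS
      have h2 := cdf_discr_le_psum hxi.1 hpi.1 (t := t) (k := 0) fun i hi =>
        absurd hi (hS i).not_ge
      rw [psum_zero] at h2
      linarith [cdf_benford_nonneg (b := b) (t + L)]

lemma sInf_levySet_of_levyRec (hb : 1 < b) (hn : 0 < n) (hL : 0 < L) (hLb : levyRec b L n = b)
    (hx : ∀ j : Fin n, x j = levyRec b L (j + 1) / b ^ L - L)
    (hp : ∀ k ≤ n, psum n p k = Real.log (levyRec b L k) / Real.log b) :
    sInf (levySet b (discr n x p)) = L :=
  IsLeast.csInf_eq ⟨mem_levySet_of_levyRec hb hL hLb hx hp, fun _ ha =>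
    le_of_mem_of_levyRec_eq hb hn hL hLb (isXi_of_levyRec hb hL hLb hx).1
      (isPi_of_levyRec hb hL hLb hp) ha⟩

lemma levyNorm_pos (hb : 1 < b) : 0 < (max b 2 - 1) / (b - 1) :=
  div_pos (by linarith [le_max_right b 2]) (by linarith)

lemma le_dLevy_benford (hb : 1 < b) (hn : 0 < n) (hL : 0 < L) (hLb : levyRec b L n = b)
    (hy : IsXi 1 b n y) (hq : IsPi n q) :
    (max b 2 - 1) / (b - 1) * L ≤ dLevy 1 b (benford b) (discr n y q) := by
  rw [dLevy_benford]
  exact mul_le_mul_of_nonneg_left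
    (le_of_mem_of_levyRec_eq hb hn hL hLb hy hq (sInf_levySet_mem hb hy hq)) (levyNorm_pos hb).le

lemma exists_psum_eq (b L : ℝ) (n : ℕ) : ∃ p : Fin n → ℝ,
    ∀ k ≤ n, psum n p k = Real.log (levyRec b L k) / Real.log b := by
  refine ⟨fun j => Real.log (levyRec b L (j + 1)) / Real.log b -
    Real.log (levyRec b L j) / Real.log b, fun k hk => ?_⟩
  induction k with
  | zero => simp [psum_zero, levyRec]
  | succ k ih =>
    have := psum_succ (q := fun j : Fin n => Real.log (levyRec b L (j + 1)) / Real.log b -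
      Real.log (levyRec b L j) / Real.log b) ⟨k, hk⟩
    simp only at this
    rw [this, ih (Nat.le_of_succ_le hk)]
    ring

lemma sInf_dLevy_benford (hb : 1 < b) (hn : 0 < n) (hL : 0 < L) (hLb : levyRec b L n = b) :
    sInf {c : ℝ | ∃ y q : Fin n → ℝ, IsXi 1 b n y ∧ IsPi n q ∧
      c = dLevy 1 b (benford b) (discr n y q)} = (max b 2 - 1) / (b - 1) * L := by
  obtain ⟨p, hp⟩ := exists_psum_eq b L n
  refine IsLeast.csInf_eq ⟨⟨fun j => levyRec b L (j + 1) / b ^ L - L, p,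
    (isXi_of_levyRec hb hL hLb fun _ => rfl).1, isPi_of_levyRec hb hL hLb hp, ?_⟩, ?_⟩
  · rw [dLevy_benford, sInf_levySet_of_levyRec hb hn hL hLb (fun _ => rfl) hp]
  · rintro c ⟨y, q, hy, hq, rfl⟩
    exact le_dLevy_benford hb hn hL hLb hy hq

end Approximation

section Asymptotics

variable {b : ℝ}

lemma tendsto_rpow_sub_rpow_neg_div (hb : 1 < b) :
    Tendsto (fun a : ℝ => (b ^ a - b ^ (-a)) / a) (nhdsWithin 0 (Ioi 0))
      (nhds (2 * Real.log b)) := by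
  have hb0 : 0 < b := by positivity
  have h1 : HasDerivAt (fun a : ℝ => b ^ a) (Real.log b) 0 := by
    simpa using (hasDerivAt_id (0 : ℝ)).const_rpow hb0
  have h2 : HasDerivAt (fun a : ℝ => b ^ (-a)) (-Real.log b) 0 := by
    simpa using (hasDerivAt_neg (0 : ℝ)).const_rpow hb0
  have h3 : HasDerivAt (fun a : ℝ => b ^ a - b ^ (-a)) (2 * Real.log b) 0 :=
    (h1.sub h2).congr_deriv (by ring)
  have h4 := h3.tendsto_slope_zero_right
  simpa [div_eq_inv_mul] using h4

lemma tendsto_levy_equation (hb : 1 < b) :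
    Tendsto (fun a : ℝ => (2 * a + b * (b ^ a - b ^ (-a))) / (2 * a + b ^ a - b ^ (-a)))
      (nhdsWithin 0 (Ioi 0)) (nhds ((1 + b * Real.log b) / (1 + Real.log b))) := by
  have hlog := Real.log_pos hb
  have hD := tendsto_rpow_sub_rpow_neg_div hb
  have h := ((hD.const_mul b).const_add 2).div (hD.const_add 2) (by positivity)
  have hlim : (2 + b * (2 * Real.log b)) / (2 + 2 * Real.log b) =
      (1 + b * Real.log b) / (1 + Real.log b) := by
    field_simp
  rw [hlim] at h
  refine h.congr' (eventually_nhdsWithin_of_forall fun a (ha : 0 < a) => ?_)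
  have h3 : b ^ (-a) < b ^ a := Real.rpow_lt_rpow_of_exponent_lt hb (by linarith)
  have h4 : 2 * a + b ^ a - b ^ (-a) ≠ 0 := by linarith
  have h5 : 2 * a + (b ^ a - b ^ (-a)) ≠ 0 := by linarith
  simp only [Pi.div_apply]
  rw [← mul_div_mul_right _ _ ha.ne']
  congr 1
  · field_simp
  · field_simp
    ring

lemma tendsto_levy_solution (hb : 1 < b) {L : ℕ → ℝ}
    (hL : ∀ m, 0 < m → 0 < L m ∧ levyRec b (L m) m = b) :
    Tendsto (fun m : ℕ => (m : ℝ) * L m) atTop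
      (nhds ((Real.log (1 + b * Real.log b) - Real.log (1 + Real.log b)) / (2 * Real.log b))) := by
  have hb0 : 0 < b := by positivity
  have hlog := Real.log_pos hb
  have hle : ∀ m, 0 < m → L m ≤ 1 / (m : ℝ) := fun m hm => by
    obtain ⟨h0, h1⟩ := hL m hm
    have h2 := rpow_le_levyRec hb h0.le m
    rw [h1] at h2
    have h3 : 2 * (m : ℝ) * L m ≤ 1 := by
      rw [← Real.rpow_le_rpow_left_iff hb, Real.rpow_one]; exact h2
    have h4 : (0 : ℝ) < m := by exact_mod_cast hm
    rw [le_div_iff₀ h4]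
    nlinarith [mul_pos h4 h0]
  have hzero : Tendsto L atTop (nhdsWithin 0 (Ioi 0)) := by
    refine tendsto_nhdsWithin_iff.2 ⟨?_, ?_⟩
    · refine tendsto_of_tendsto_of_tendsto_of_le_of_le' tendsto_const_nhds
        tendsto_one_div_atTop_nhds_zero_nat ?_ ?_
      · filter_upwards [eventually_gt_atTop 0] with m hm using (hL m hm).1.le
      · filter_upwards [eventually_gt_atTop 0] with m hm using hle m hm
    · filter_upwards [eventually_gt_atTop 0] with m hm using (hL m hm).1
  have hne : (1 + b * Real.log b) / (1 + Real.log b) ≠ 0 := by positivity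
  have h := (((tendsto_levy_equation hb).comp hzero).log hne).div_const (2 * Real.log b)
  rw [Real.log_div (by positivity) (by positivity)] at h
  refine h.congr' ?_
  filter_upwards [eventually_gt_atTop 0] with m hm
  obtain ⟨h0, h1⟩ := hL m hm
  rw [Function.comp_apply, ← (levy_equation_iff hb h0 m).2 h1, Real.log_rpow hb0]
  field_simp

end Asymptotics

/-- Cor. 3.11: the unique best Lévy-distance approximation of the
Benford measure `β_b` with at most `n` atoms, its distance `ω_b·L`, and the
`d_L`-quantization coefficient of `β_b`. -/
theorem best_dLevy_benford (b : ℝ) (hb : 1 < b) (n : ℕ) (hn : 0 < n) :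
    (∃! L : ℝ, 0 < L ∧
      b ^ (2 * (n : ℝ) * L) =
        (2 * L + b * (b ^ L - b ^ (-L))) / (2 * L + b ^ L - b ^ (-L))) ∧
    (∀ L : ℝ, 0 < L →
      b ^ (2 * (n : ℝ) * L) =
        (2 * L + b * (b ^ L - b ^ (-L))) / (2 * L + b ^ L - b ^ (-L)) →
      ∀ x p : Fin n → ℝ,
        (∀ j : Fin n, x j =
          b ^ ((2 * (j : ℝ) + 1) * L) +
            2 * L * (b ^ (2 * ((j : ℝ) + 1) * L) - 1) / (b ^ (2 * L) - 1) - L) →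
        (∀ j : Fin n, psum n p ((j : ℕ) + 1) =
          Real.log (b ^ ((2 * (j : ℝ) + 1) * L) +
              2 * L * (b ^ (2 * ((j : ℝ) + 1) * L) - 1) / (b ^ (2 * L) - 1)) /
            Real.log b + L) →
        IsXi 1 b n x ∧ IsPi n p ∧
        (∀ y q : Fin n → ℝ, IsXi 1 b n y → IsPi n q →
          dLevy 1 b (benford b) (discr n x p) ≤ dLevy 1 b (benford b) (discr n y q)) ∧
        (∀ y q : Fin n → ℝ, IsXi 1 b n y → IsPi n q →
          (∀ y' q' : Fin n → ℝ, IsXi 1 b n y' → IsPi n q' →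
            dLevy 1 b (benford b) (discr n y q) ≤ dLevy 1 b (benford b) (discr n y' q')) →
          discr n y q = discr n x p) ∧
        (∀ j : Fin n, x j = b ^ (psum n p ((j : ℕ) + 1) - L) - L) ∧
        (∀ j : Fin n, psum n p ((j : ℕ) + 1) = Real.log (x j + L) / Real.log b + L) ∧
        (Set.range x).ncard = n ∧
        dLevy 1 b (benford b) (discr n x p) = (max b 2 - 1) / (b - 1) * L) ∧
    Filter.Tendsto
      (fun m : ℕ => (m : ℝ) * sInf {c : ℝ | ∃ y q : Fin m → ℝ, IsXi 1 b m y ∧ IsPi m q ∧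
        c = dLevy 1 b (benford b) (discr m y q)})
      Filter.atTop
      (nhds ((max b 2 - 1) / (2 * b - 2) *
        ((Real.log (1 + b * Real.log b) - Real.log (1 + Real.log b)) / Real.log b))) := by
  have hb0 : 0 < b := by positivity
  have hlog := Real.log_pos hb
  refine ⟨?_, ?_, ?_⟩
  · obtain ⟨L, hL, hLb⟩ := exists_levyRec_eq hb hn
    refine ⟨L, ⟨hL, (levy_equation_iff hb hL n).2 hLb⟩, fun K ⟨hK, hKeq⟩ => ?_⟩
    refine (levyRec_strictMonoOn hb hn).injOn (mem_Ici.2 hK.le) (mem_Ici.2 hL.le) ?_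
    simp only [hLb, (levy_equation_iff hb hK n).1 hKeq]
  · intro L hL hLeq x p hx hp
    have hLb := (levy_equation_iff hb hL n).1 hLeq
    simp only [levyRec_div hb hL] at hx hp
    have hlogdiv : ∀ k, Real.log (levyRec b L k / b ^ L) / Real.log b + L =
        Real.log (levyRec b L k) / Real.log b := fun k => by
      have := one_le_levyRec hb hL.le k
      rw [Real.log_div (by positivity) (by positivity), Real.log_rpow hb0]
      field_simp
      ring
    have hP : ∀ k ≤ n, psum n p k = Real.log (levyRec b L k) / Real.log b := by
      intro k hk
      cases k with
      | zero => simp [psum_zero, levyRec]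
      | succ k => rw [← hlogdiv]; exact hp ⟨k, hk⟩
    obtain ⟨hxi, hmono⟩ := isXi_of_levyRec hb hL hLb hx
    have hd : dLevy 1 b (benford b) (discr n x p) = (max b 2 - 1) / (b - 1) * L := by
      rw [dLevy_benford, sInf_levySet_of_levyRec hb hn hL hLb hx hP]
    have hpi := isPi_of_levyRec hb hL hLb hP
    refine ⟨hxi, hpi, ?_, ?_, ?_, ?_, ?_, hd⟩
    · intro y q hy hq
      rw [hd]
      exact le_dLevy_benford hb hn hL hLb hy hq
    · intro y q hy hq hmin
      have hmem := sInf_levySet_mem hb hy hq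
      have hle := hmin x p hxi hpi
      rw [hd, dLevy_benford, mul_le_mul_iff_right₀ (levyNorm_pos hb)] at hle
      rw [le_antisymm hle (le_of_mem_of_levyRec_eq hb hn hL hLb hy hq hmem)] at hmem
      have hyx : y = x := funext fun j => by
        rw [eq_of_mem_levySet hb hLb hy hq hmem j, hx]
      have hqp : q = p := eq_of_psum_eq fun k hk => by
        rw [psum_eq_of_mem_levySet hb hLb hy hq hmem hk, hP k hk]
      rw [hyx, hqp]
    · intro j
      have := one_le_levyRec hb hL.le (j + 1)
      rw [hx, hp, add_sub_cancel_right, ← Real.logb, Real.rpow_logb hb0 hb.ne' (by positivity)]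
    · intro j
      rw [hp, hx, sub_add_cancel]
    · rw [← Set.image_univ, Set.ncard_image_of_injective _ hmono.injective, Set.ncard_univ,
        Nat.card_fin]
  · choose! L hL using fun (m : ℕ) (hm : 0 < m) => exists_levyRec_eq hb hm
    have h := (tendsto_levy_solution hb hL).const_mul ((max b 2 - 1) / (b - 1))
    have hlim : (max b 2 - 1) / (b - 1) *
        ((Real.log (1 + b * Real.log b) - Real.log (1 + Real.log b)) / (2 * Real.log b)) =
        (max b 2 - 1) / (2 * b - 2) *
        ((Real.log (1 + b * Real.log b) - Real.log (1 + Real.log b)) / Real.log b) := by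
      rw [div_mul_div_comm, div_mul_div_comm]
      congr 1
      ring
    rw [← hlim]
    refine h.congr' ?_
    filter_upwards [eventually_gt_atTop 0] with m hm
    rw [sInf_dLevy_benford hb hm (hL m hm).1 (hL m hm).2]
    ring

end BenfordApprox
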